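/- Let h be harmonic on a domain Ω ⊆ ℝⁿ containing the closed ball of radius R centered at x. Define H(r) = (1/|∂B_r|) ∫_{∂B_r(x)} h² for 0 < r ≤ R, and assume h is not identically zero near x. Then the function t ↦ log H(e^t) is convex on (-∞, log R]. -/

import Mathlib

open MeasureTheory

/-- The Euclidean Laplacian of a function. -/
noncomputable def lap {m : ℕ} (u : EuclideanSpace ℝ (Fin m) → ℝ)
    (x : EuclideanSpace ℝ (Fin m)) : ℝ :=
  ∑ i : Fin m, fderiv ℝ (fun y => fderiv ℝ u y (EuclideanSpace.single i (1:ℝ))) x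
      (EuclideanSpace.single i (1:ℝ))


open Filter Topology

noncomputable section LogConv

abbrev ES (n : ℕ) := EuclideanSpace ℝ (Fin n)

/-- Basis vector. -/
abbrev bv {n : ℕ} (i : Fin n) : ES n := EuclideanSpace.single i (1:ℝ)

/-- Generator of rotations in the `i,j` plane. -/
def rotA {n : ℕ} (i j : Fin n) : ES n →L[ℝ] ES n :=
  InnerProductSpace.rankOne ℝ (bv j) (bv i) - InnerProductSpace.rankOne ℝ (bv i) (bv j)

lemma rotA_apply {n : ℕ} (i j : Fin n) (y : ES n) :
    rotA i j y = y i • bv j - y j • bv i := by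
  simp [rotA, EuclideanSpace.inner_single_left]

lemma rotA_skew {n : ℕ} (i j : Fin n) : rotA i j ∈ skewAdjoint (ES n →L[ℝ] ES n) := by
  rw [skewAdjoint.mem_iff, ContinuousLinearMap.star_eq_adjoint]
  simp [rotA]

/-- Euler operator. -/
def eulP {n : ℕ} (f : ES n → ℝ) (y : ES n) : ℝ := fderiv ℝ f y y

/-- Rotational derivative. -/
def rotL {n : ℕ} (i j : Fin n) (f : ES n → ℝ) (y : ES n) : ℝ := fderiv ℝ f y (rotA i j y)

/-- Spherical integral functional. -/
def sphM {n : ℕ} (σ : Measure (ES n)) (f : ES n → ℝ) (t : ℝ) : ℝ :=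
  ∫ ω, f (Real.exp t • ω) ∂σ

lemma restrict_eq {n : ℕ} {σ : Measure (ES n)} (hS : ∀ᵐ ω ∂σ, ‖ω‖ = 1) :
    σ.restrict (Metric.closedBall 0 1) = σ := by
  apply Measure.restrict_eq_self_of_ae_mem
  filter_upwards [hS] with ω hω
  simp [hω]

lemma int_cont {n : ℕ} {σ : Measure (ES n)} [IsFiniteMeasure σ] (hS : ∀ᵐ ω ∂σ, ‖ω‖ = 1)
    {f : ES n → ℝ} (hf : Continuous f) : Integrable f σ := by
  rw [← restrict_eq hS]
  exact hf.continuousOn.integrableOn_compact (isCompact_closedBall _ _)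

lemma cont_param {n : ℕ} {σ : Measure (ES n)} [IsFiniteMeasure σ] (hS : ∀ᵐ ω ∂σ, ‖ω‖ = 1)
    {F : ℝ → ES n → ℝ} (hF : Continuous F.uncurry) : Continuous (fun t => ∫ ω, F t ω ∂σ) := by
  rw [← restrict_eq hS]
  exact continuous_parametric_integral_of_continuous hF (isCompact_closedBall _ _)

lemma deriv_param {n : ℕ} {σ : Measure (ES n)} [IsFiniteMeasure σ] (hS : ∀ᵐ ω ∂σ, ‖ω‖ = 1)
    {F F' : ℝ → ES n → ℝ} (hF : Continuous F.uncurry) (hF' : Continuous F'.uncurry)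
    (hd : ∀ t ω, HasDerivAt (fun s => F s ω) (F' t ω) t) (t : ℝ) :
    HasDerivAt (fun s => ∫ ω, F s ω ∂σ) (∫ ω, F' t ω ∂σ) t := by
  obtain ⟨C, hC⟩ := ((isCompact_closedBall t 1).prod
    (isCompact_closedBall (0 : ES n) 1)).exists_bound_of_continuousOn hF'.continuousOn
  refine (hasDerivAt_integral_of_dominated_loc_of_deriv_le (bound := fun _ => C)
    (Metric.closedBall_mem_nhds t one_pos)
    (Eventually.of_forall fun s => ?_) ?_ ?_ ?_ (integrable_const _) ?_).2
  · exact (hF.comp (Continuous.prodMk_right s)).aestronglyMeasurable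
  · exact int_cont hS (hF.comp (Continuous.prodMk_right t))
  · exact (hF'.comp (Continuous.prodMk_right t)).aestronglyMeasurable
  · filter_upwards [hS] with ω hω s hs
    exact hC (s, ω) ⟨hs, by simp [hω]⟩
  · exact Eventually.of_forall fun ω s _ => hd s ω

lemma eulP_cont {n : ℕ} {f : ES n → ℝ} (hf : ContDiff ℝ 1 f) : Continuous (eulP f) :=
  (hf.continuous_fderiv (by simp)).clm_apply continuous_id

lemma rotL_cont {n : ℕ} {f : ES n → ℝ} (hf : ContDiff ℝ 1 f) (i j) : Continuous (rotL i j f) :=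
  (hf.continuous_fderiv (by simp)).clm_apply (rotA i j).continuous

lemma eulP_cd {n : ℕ} {f : ES n → ℝ} (hf : ContDiff ℝ 2 f) : ContDiff ℝ 1 (eulP f) :=
  (hf.fderiv_right (m := 1) (by norm_num)).clm_apply contDiff_id

lemma rotL_cd {n : ℕ} {f : ES n → ℝ} (hf : ContDiff ℝ 2 f) (i j) : ContDiff ℝ 1 (rotL i j f) :=
  (hf.fderiv_right (m := 1) (by norm_num)).clm_apply (rotA i j).contDiff

lemma sphM_deriv {n : ℕ} {σ : Measure (ES n)} [IsFiniteMeasure σ] (hS : ∀ᵐ ω ∂σ, ‖ω‖ = 1)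
    {f : ES n → ℝ} (hf : ContDiff ℝ 1 f) (t : ℝ) :
    HasDerivAt (sphM σ f) (sphM σ (eulP f) t) t := by
  refine deriv_param hS (F := fun t ω => f (Real.exp t • ω))
    (F' := fun t ω => eulP f (Real.exp t • ω)) ?_ ?_ ?_ t
  · exact hf.continuous.comp (by fun_prop)
  · exact (eulP_cont hf).comp (by fun_prop)
  · intro t ω
    have h1 : HasDerivAt (fun s => Real.exp s • ω) (Real.exp t • ω) t :=
      (Real.hasDerivAt_exp t).smul_const ω
    exact ((hf.differentiable (by simp)) _).hasFDerivAt.comp_hasDerivAt t h1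

lemma sphM_rot {n : ℕ} {σ : Measure (ES n)} [IsFiniteMeasure σ] (hS : ∀ᵐ ω ∂σ, ‖ω‖ = 1)
    (hinv : ∀ e : ES n ≃ₗᵢ[ℝ] ES n, MeasurePreserving e σ σ)
    {f : ES n → ℝ} (hf : ContDiff ℝ 1 f) (i j : Fin n) (t : ℝ) :
    sphM σ (rotL i j f) t = 0 := by
  have hexpc : Continuous (fun s : ℝ => NormedSpace.exp (s • rotA i j)) :=
    (differentiable_exp_smul_const ℝ (rotA i j)).continuous
  have key := deriv_param hS
    (F := fun s ω => f (Real.exp t • (NormedSpace.exp (s • rotA i j)) ω))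
    (F' := fun s ω => fderiv ℝ f (Real.exp t • (NormedSpace.exp (s • rotA i j)) ω)
      (Real.exp t • (rotA i j * NormedSpace.exp (s • rotA i j)) ω)) ?_ ?_ ?_ 0
  · have hconst : ∀ s : ℝ, ∫ ω, f (Real.exp t • (NormedSpace.exp (s • rotA i j)) ω) ∂σ
        = ∫ ω, f (Real.exp t • ω) ∂σ := by
      intro s
      let _ : NormedAlgebra ℚ (ES n →L[ℝ] ES n) := NormedAlgebra.restrictScalars ℚ ℝ _
      have hu : NormedSpace.exp (s • rotA i j) ∈ unitary (ES n →L[ℝ] ES n) :=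
        NormedSpace.exp_mem_unitary_of_mem_skewAdjoint
          (skewAdjoint.smul_mem s (rotA_skew i j))
      let e := Unitary.linearIsometryEquiv ⟨_, hu⟩
      exact (hinv e).integral_comp e.toHomeomorph.measurableEmbedding
        (fun ω => f (Real.exp t • ω))
    simp_rw [hconst] at key
    have := key.unique (hasDerivAt_const _ _)
    have e0 : NormedSpace.exp ((0:ℝ) • rotA i j) = 1 :=
      (congrArg NormedSpace.exp (zero_smul ℝ (rotA i j))).trans NormedSpace.exp_zero
    simp only [e0] at this
    simpa [sphM, rotL] using this
  · apply hf.continuous.comp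
    exact ((hexpc.comp continuous_fst).clm_apply continuous_snd).const_smul (Real.exp t)
  · apply ((hf.continuous_fderiv (by simp)).comp _).clm_apply
    · exact (((continuous_const (y := rotA i j)).mul
        (hexpc.comp continuous_fst)).clm_apply continuous_snd).const_smul (Real.exp t)
    · exact ((hexpc.comp continuous_fst).clm_apply continuous_snd).const_smul (Real.exp t)
  · intro s ω
    have h1 := ((hasDerivAt_exp_smul_const' (rotA i j) s).clm_apply
      (hasDerivAt_const s ω)).const_smul (Real.exp t)
    simp only [map_zero, add_zero] at h1
    exact ((hf.differentiable (by simp)) _).hasFDerivAt.comp_hasDerivAt s h1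

lemma eulP_mul {n : ℕ} {f k : ES n → ℝ} (hf : ContDiff ℝ 1 f) (hk : ContDiff ℝ 1 k) (y) :
    eulP (fun z => f z * k z) y = eulP f y * k y + f y * eulP k y := by
  have := fderiv_fun_mul ((hf.differentiable (by simp)) y) ((hk.differentiable (by simp)) y)
  simp only [eulP, this]
  simp
  ring

lemma rotL_mul {n : ℕ} {f k : ES n → ℝ} (hf : ContDiff ℝ 1 f) (hk : ContDiff ℝ 1 k) (i j) (y) :
    rotL i j (fun z => f z * k z) y = rotL i j f y * k y + f y * rotL i j k y := by
  have := fderiv_fun_mul ((hf.differentiable (by simp)) y) ((hk.differentiable (by simp)) y)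
  simp only [rotL, this]
  simp
  ring

lemma fderiv_app {n : ℕ} {g : ES n → ℝ} (hg : ContDiff ℝ 2 g) (A : ES n →L[ℝ] ES n) (y v : ES n) :
    fderiv ℝ (fun z => fderiv ℝ g z (A z)) y v =
      fderiv ℝ (fderiv ℝ g) y v (A y) + fderiv ℝ g y (A v) := by
  have h1 : DifferentiableAt ℝ (fderiv ℝ g) y :=
    (hg.fderiv_right (m := 1) (by norm_num)).differentiable (by simp) y
  rw [fderiv_clm_apply h1 A.differentiableAt]
  simp
  ring

lemma eulP_eulP {n : ℕ} {g : ES n → ℝ} (hg : ContDiff ℝ 2 g) (y : ES n) :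
    eulP (eulP g) y = fderiv ℝ (fderiv ℝ g) y y y + fderiv ℝ g y y := 
  fderiv_app hg (ContinuousLinearMap.id ℝ _) y y

lemma rotL_rotL {n : ℕ} {g : ES n → ℝ} (hg : ContDiff ℝ 2 g) (i j) (y : ES n) :
    rotL i j (rotL i j g) y = fderiv ℝ (fderiv ℝ g) y (rotA i j y) (rotA i j y)
      + fderiv ℝ g y (rotA i j (rotA i j y)) := 
  fderiv_app hg (rotA i j) y _

lemma eul_rot_comm {n : ℕ} {g : ES n → ℝ} (hg : ContDiff ℝ 2 g) (i j) (y : ES n) :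
    eulP (rotL i j g) y = rotL i j (eulP g) y := by
  have h1 := fderiv_app hg (rotA i j) y y
  have h2 := fderiv_app hg (ContinuousLinearMap.id ℝ _) y (rotA i j y)
  have hs : IsSymmSndFDerivAt ℝ g y := hg.contDiffAt.isSymmSndFDerivAt (by simp)
  change fderiv ℝ (fun z => fderiv ℝ g z (rotA i j z)) y y =
    fderiv ℝ (fun z => fderiv ℝ g z (ContinuousLinearMap.id ℝ _ z)) y (rotA i j y)
  rw [h1, h2, hs.eq]
  simp

lemma lap_eq {n : ℕ} {g : ES n → ℝ} (hg : ContDiff ℝ 2 g) (y : ES n) :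
    lap g y = ∑ i, fderiv ℝ (fderiv ℝ g) y (bv i) (bv i) := by
  have h1 : DifferentiableAt ℝ (fderiv ℝ g) y :=
    (hg.fderiv_right (m := 1) (by norm_num)).differentiable (by simp) y
  unfold lap
  refine Finset.sum_congr rfl fun i _ => ?_
  rw [fderiv_clm_apply h1 (differentiableAt_const _)]
  simp

lemma sum_rot {n : ℕ} {g : ES n → ℝ} (hg : ContDiff ℝ 2 g) (y : ES n) :
    ∑ i, ∑ j, rotL i j (rotL i j g) y =
      2 * (‖y‖^2 * lap g y - fderiv ℝ (fderiv ℝ g) y y y - (n - 1) * fderiv ℝ g y y) := by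
  have hy : y = ∑ i, y i • bv i := by
    ext k
    simp [Finset.sum_apply, Pi.single_apply]
  set Q := fderiv ℝ (fderiv ℝ g) y with hQ
  set l := fderiv ℝ g y with hl
  have hlap := lap_eq hg y
  rw [← hQ] at hlap
  have hsym : ∀ a b, Q a b = Q b a := by
    have hs : IsSymmSndFDerivAt ℝ g y := hg.contDiffAt.isSymmSndFDerivAt (by simp)
    exact fun a b => hs.eq a b
  have hQy : Q y y = ∑ i, ∑ j, y i * y j * Q (bv i) (bv j) := by
    conv_lhs => rw [hy]
    simp [Finset.mul_sum, mul_assoc]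
    exact Finset.sum_congr rfl fun a _ => Finset.sum_congr rfl fun b _ => by rw [hsym]
  have hly : l y = ∑ i, y i * l (bv i) := by
    conv_lhs => rw [hy]
    simp
  have hterm : ∀ i j, rotL i j (rotL i j g) y =
      y i ^ 2 * Q (bv j) (bv j) + y j ^ 2 * Q (bv i) (bv i) - 2 * (y i * y j * Q (bv i) (bv j))
      - y i * l (bv i) - y j * l (bv j) + (if i = j then 2 * (y i * l (bv i)) else 0) := by
    intro i j
    rw [rotL_rotL hg, ← hQ, ← hl]
    simp only [rotA_apply]
    simp only [map_sub, map_smul, sub_apply, smul_apply,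
      smul_eq_mul, PiLp.sub_apply, PiLp.smul_apply, PiLp.single_apply]
    rw [hsym (bv j) (bv i)]
    by_cases hij : i = j
    · subst hij; simp; ring
    · simp [hij, Ne.symm hij]; ring
  simp_rw [hterm]
  rw [EuclideanSpace.real_norm_sq_eq, hlap, hQy, hly]
  simp only [Finset.sum_add_distrib, Finset.sum_sub_distrib, ← Finset.mul_sum, ← Finset.sum_mul,
    Finset.sum_const, Finset.card_univ, Fintype.card_fin, Finset.sum_ite_eq, Finset.mem_univ,
    if_true, nsmul_eq_mul]
  have : ∑ x, y x * ((n:ℝ) * l (bv x)) = n * ∑ x, y x * l (bv x) := by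
    rw [Finset.mul_sum]
    exact Finset.sum_congr rfl fun _ _ => by ring
  simp only [this]
  ring

lemma eul_harm {n : ℕ} {g : ES n → ℝ} (hg : ContDiff ℝ 2 g) {y : ES n} (hl : lap g y = 0) :
    eulP (eulP g) y = - (n - 2) * eulP g y - (1/2) * ∑ i, ∑ j, rotL i j (rotL i j g) y := by
  rw [eulP_eulP hg, sum_rot hg, hl]
  simp only [eulP]
  ring

lemma sphM_int {n : ℕ} {σ : Measure (ES n)} [IsFiniteMeasure σ] (hS : ∀ᵐ ω ∂σ, ‖ω‖ = 1)
    {f : ES n → ℝ} (hf : Continuous f) (t : ℝ) : Integrable (fun ω => f (Real.exp t • ω)) σ :=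
  int_cont hS (hf.comp (by fun_prop))

lemma sphM_add {n : ℕ} {σ : Measure (ES n)} [IsFiniteMeasure σ] (hS : ∀ᵐ ω ∂σ, ‖ω‖ = 1)
    {f k : ES n → ℝ} (hf : Continuous f) (hk : Continuous k) (t : ℝ) :
    sphM σ (fun y => f y + k y) t = sphM σ f t + sphM σ k t :=
  integral_add (sphM_int hS hf t) (sphM_int hS hk t)

lemma sphM_smul {n : ℕ} (σ : Measure (ES n)) (c : ℝ) (f : ES n → ℝ) (t : ℝ) :
    sphM σ (fun y => c * f y) t = c * sphM σ f t :=
  integral_const_mul _ _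

lemma sphM_sum {n : ℕ} {σ : Measure (ES n)} [IsFiniteMeasure σ] (hS : ∀ᵐ ω ∂σ, ‖ω‖ = 1)
    {f : Fin n → Fin n → ES n → ℝ} (hf : ∀ i j, Continuous (f i j)) (t : ℝ) :
    sphM σ (fun y => ∑ i, ∑ j, f i j y) t = ∑ i, ∑ j, sphM σ (f i j) t := by
  unfold sphM
  rw [integral_finsetSum]
  · refine Finset.sum_congr rfl fun i _ => ?_
    rw [integral_finsetSum]
    exact fun j _ => sphM_int hS (hf i j) t
  · exact fun i _ => integrable_finsetSum _ fun j _ => sphM_int hS (hf i j) t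

lemma sphM_congr {n : ℕ} {σ : Measure (ES n)} (hS : ∀ᵐ ω ∂σ, ‖ω‖ = 1)
    {f k : ES n → ℝ} {T : ℝ} (h : ∀ y, ‖y‖ < Real.exp T → f y = k y) {t : ℝ} (ht : t < T) :
    sphM σ f t = sphM σ k t := by
  apply integral_congr_ae
  filter_upwards [hS] with ω hω
  apply h
  rw [norm_smul, hω]
  simpa using ht

lemma sphM_ibp {n : ℕ} {σ : Measure (ES n)} [IsFiniteMeasure σ] (hS : ∀ᵐ ω ∂σ, ‖ω‖ = 1)
    (hinv : ∀ e : ES n ≃ₗᵢ[ℝ] ES n, MeasurePreserving e σ σ)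
    {f k : ES n → ℝ} (hf : ContDiff ℝ 1 f) (hk : ContDiff ℝ 1 k) (i j : Fin n) (t : ℝ) :
    sphM σ (fun y => f y * rotL i j k y) t = - sphM σ (fun y => rotL i j f y * k y) t := by
  have h1 := sphM_rot hS hinv (hf.mul hk) i j t
  have h2 : rotL i j (fun y => f y * k y) = fun y => rotL i j f y * k y + f y * rotL i j k y :=
    funext fun y => rotL_mul hf hk i j y
  have h3 := sphM_add hS ((rotL_cont hf i j).mul hk.continuous)
    (hf.continuous.mul (rotL_cont hk i j)) t
  simp only [Pi.mul_apply] at h3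
  rw [h2, h3] at h1
  change sphM σ (fun y => rotL i j f y * k y) t + sphM σ (fun y => f y * rotL i j k y) t = 0 at h1
  linarith

/-- Spherical Laplacian. -/
def sLap {n : ℕ} (g : ES n → ℝ) (y : ES n) : ℝ := (1/2) * ∑ i, ∑ j, rotL i j (rotL i j g) y

/-- Bilinear form of the spherical gradient. -/
def sGrad {n : ℕ} (f g : ES n → ℝ) (y : ES n) : ℝ := (1/2) * ∑ i, ∑ j, rotL i j f y * rotL i j g y

lemma sLap_cont {n : ℕ} {g : ES n → ℝ} (hg : ContDiff ℝ 2 g) : Continuous (sLap g) :=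
  continuous_const.mul (continuous_finsetSum _ fun i _ => continuous_finsetSum _ fun j _ =>
    rotL_cont (rotL_cd hg i j) i j)

lemma sGrad_cd {n : ℕ} {g : ES n → ℝ} (hg : ContDiff ℝ 2 g) : ContDiff ℝ 1 (sGrad g g) :=
  contDiff_const.mul (ContDiff.sum fun i _ => ContDiff.sum fun j _ =>
    (rotL_cd hg i j).mul (rotL_cd hg i j))

lemma sphM_ibp_sum {n : ℕ} {σ : Measure (ES n)} [IsFiniteMeasure σ] (hS : ∀ᵐ ω ∂σ, ‖ω‖ = 1)
    (hinv : ∀ e : ES n ≃ₗᵢ[ℝ] ES n, MeasurePreserving e σ σ)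
    {f g : ES n → ℝ} (hf : ContDiff ℝ 1 f) (hg : ContDiff ℝ 2 g) (t : ℝ) :
    sphM σ (fun y => f y * sLap g y) t = - sphM σ (sGrad f g) t := by
  have e1 : (fun y => f y * sLap g y) =
      fun y => (1/2) * ∑ i, ∑ j, f y * rotL i j (rotL i j g) y := by
    ext y
    simp only [sLap, Finset.mul_sum]
    exact Finset.sum_congr rfl fun _ _ => Finset.sum_congr rfl fun _ _ => by ring
  have e2 : sGrad f g = fun y => (1/2) * ∑ i, ∑ j, rotL i j f y * rotL i j g y := rfl
  rw [e1, e2, sphM_smul, sphM_smul, sphM_sum hS, sphM_sum hS]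
  · simp_rw [sphM_ibp hS hinv hf (rotL_cd hg _ _)]
    simp
  · exact fun i j => (rotL_cont hf i j).mul (rotL_cd hg i j).continuous
  · exact fun i j => hf.continuous.mul (rotL_cont (rotL_cd hg i j) i j)

lemma eulP_sGrad {n : ℕ} {g : ES n → ℝ} (hg : ContDiff ℝ 2 g) (y : ES n) :
    eulP (sGrad g g) y = 2 * sGrad (eulP g) g y := by
  have hd : ∀ i j, DifferentiableAt ℝ (fun z => rotL i j g z * rotL i j g z) y := fun i j =>
    ((rotL_cd hg i j).mul (rotL_cd hg i j)).differentiable (by simp) y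
  have h1 : eulP (sGrad g g) y = (1/2) * ∑ i, ∑ j,
      eulP (fun z => rotL i j g z * rotL i j g z) y := by
    unfold eulP sGrad
    rw [fderiv_const_mul (DifferentiableAt.fun_sum fun i _ => DifferentiableAt.fun_sum
      fun j _ => hd i j), fderiv_fun_sum (fun i _ => DifferentiableAt.fun_sum
      fun j _ => hd i j)]
    simp_rw [fderiv_fun_sum (fun j _ => hd _ j)]
    simp
  rw [h1]
  simp_rw [eulP_mul (rotL_cd hg _ _) (rotL_cd hg _ _), eul_rot_comm hg]
  simp only [sGrad, Finset.mul_sum]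
  exact Finset.sum_congr rfl fun _ _ => Finset.sum_congr rfl fun _ _ => by ring

section ODE

variable {n : ℕ} {σ : Measure (ES n)} [IsFiniteMeasure σ] (hS : ∀ᵐ ω ∂σ, ‖ω‖ = 1)
    (hinv : ∀ e : ES n ≃ₗᵢ[ℝ] ES n, MeasurePreserving e σ σ)
    {g : ES n → ℝ} (hg : ContDiff ℝ 2 g) {T : ℝ}
    (hl : ∀ y, ‖y‖ < Real.exp T → lap g y = 0)

/-- Mass. -/
def fH (σ : Measure (ES n)) (g : ES n → ℝ) : ℝ → ℝ := sphM σ (fun y => g y * g y)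
/-- Half derivative of the mass. -/
def fJ (σ : Measure (ES n)) (g : ES n → ℝ) : ℝ → ℝ := sphM σ (fun y => g y * eulP g y)
/-- Radial energy. -/
def fA (σ : Measure (ES n)) (g : ES n → ℝ) : ℝ → ℝ := sphM σ (fun y => eulP g y * eulP g y)
/-- Tangential energy. -/
def fB (σ : Measure (ES n)) (g : ES n → ℝ) : ℝ → ℝ := sphM σ (sGrad g g)

lemma fH_deriv (hS : ∀ᵐ ω ∂σ, ‖ω‖ = 1) (hg : ContDiff ℝ 2 g) (t : ℝ) :
    HasDerivAt (fH σ g) (2 * fJ σ g t) t := by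
  have hg1 : ContDiff ℝ 1 g := hg.of_le (by norm_num)
  have := sphM_deriv hS (hg1.mul hg1) t
  unfold fH fJ
  rw [← sphM_smul]
  convert this using 2
  ext y
  rw [eulP_mul hg1 hg1]
  ring

lemma fJ_deriv (hS : ∀ᵐ ω ∂σ, ‖ω‖ = 1)
    (hinv : ∀ e : ES n ≃ₗᵢ[ℝ] ES n, MeasurePreserving e σ σ) (hg : ContDiff ℝ 2 g)
    (hl : ∀ y, ‖y‖ < Real.exp T → lap g y = 0) {t : ℝ} (ht : t < T) :
    HasDerivAt (fJ σ g) (fA σ g t + fB σ g t - (n - 2) * fJ σ g t) t := by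
  have hg1 : ContDiff ℝ 1 g := hg.of_le (by norm_num)
  have hP := eulP_cd hg
  have := sphM_deriv hS (hg1.mul hP) t
  unfold fJ
  convert this using 1
  rw [sphM_congr hS (f := eulP _) (k := fun y => eulP g y * eulP g y + (-(n-2) * (g y * eulP g y) +
    (-1) * (g y * sLap g y))) _ ht]
  · rw [sphM_add hS, sphM_add hS, sphM_smul, sphM_smul, sphM_ibp_sum hS hinv hg1 hg]
    · unfold fA fB; ring
    · exact continuous_const.mul (hg1.continuous.mul hP.continuous)
    · exact continuous_const.mul (hg1.continuous.mul (sLap_cont hg))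
    · exact hP.continuous.mul hP.continuous
    · exact (continuous_const.mul (hg1.continuous.mul hP.continuous)).add
        (continuous_const.mul (hg1.continuous.mul (sLap_cont hg)))
  · intro y hy
    rw [eulP_mul hg1 hP, eul_harm hg (hl y hy)]
    unfold sLap
    ring

lemma fA_deriv (hS : ∀ᵐ ω ∂σ, ‖ω‖ = 1)
    (hinv : ∀ e : ES n ≃ₗᵢ[ℝ] ES n, MeasurePreserving e σ σ) (hg : ContDiff ℝ 2 g)
    (hl : ∀ y, ‖y‖ < Real.exp T → lap g y = 0) {t : ℝ} (ht : t < T) :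
    HasDerivAt (fA σ g) (2 * sphM σ (sGrad (eulP g) g) t - 2 * (n - 2) * fA σ g t) t := by
  have hP := eulP_cd hg
  have := sphM_deriv hS (hP.mul hP) t
  unfold fA
  convert this using 1
  rw [sphM_congr hS (f := eulP _) (k := fun y => (-2*(n-2)) * (eulP g y * eulP g y) +
    (-2) * (eulP g y * sLap g y)) _ ht]
  · rw [sphM_add hS, sphM_smul, sphM_smul, sphM_ibp_sum hS hinv hP hg]
    · ring
    · exact continuous_const.mul (hP.continuous.mul hP.continuous)
    · exact continuous_const.mul (hP.continuous.mul (sLap_cont hg))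
  · intro y hy
    rw [eulP_mul hP hP, eul_harm hg (hl y hy)]
    unfold sLap
    ring

lemma fB_deriv (hS : ∀ᵐ ω ∂σ, ‖ω‖ = 1) (hg : ContDiff ℝ 2 g) (t : ℝ) :
    HasDerivAt (fB σ g) (2 * sphM σ (sGrad (eulP g) g) t) t := by
  have := sphM_deriv hS (sGrad_cd hg) t
  unfold fB
  rw [← sphM_smul]
  convert this using 2
  ext y
  rw [eulP_sGrad hg]

/-- The limit at `-∞` through a continuous function of the radius. -/
lemma lim_aux {φ : ℝ → ℝ} (hφ : Continuous φ) (h0 : φ 0 = 0) :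
    Tendsto (fun t => φ (Real.exp t)) atBot (𝓝 0) := by
  have := (hφ.tendsto 0).comp Real.tendsto_exp_atBot
  rwa [h0] at this

lemma fJ_lim (hn : 1 ≤ n) (hS : ∀ᵐ ω ∂σ, ‖ω‖ = 1)
    (hinv : ∀ e : ES n ≃ₗᵢ[ℝ] ES n, MeasurePreserving e σ σ) (hg : ContDiff ℝ 2 g) :
    Tendsto (fun t => Real.exp ((n - 2) * t) * fJ σ g t) atBot (𝓝 0) := by
  have hg1 : ContDiff ℝ 1 g := hg.of_le (by norm_num)
  have hD := hg1.continuous_fderiv (by simp)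
  have hc : Continuous (fun r : ℝ => r ^ (n-1) *
      ∫ ω, g (r • ω) * fderiv ℝ g (r • ω) ω ∂σ) := by
    refine (continuous_pow _).mul (cont_param hS (F := fun r ω =>
      g (r • ω) * fderiv ℝ g (r • ω) ω) ?_)
    exact (hg1.continuous.comp (continuous_fst.smul continuous_snd)).mul
      ((hD.comp (continuous_fst.smul continuous_snd)).clm_apply continuous_snd)
  refine (lim_aux hc ?_).congr fun t => ?_
  · have h1 : ∫ ω, fderiv ℝ g 0 ω ∂σ = 0 := by
      have := (hinv (LinearIsometryEquiv.neg ℝ)).integral_comp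
        (LinearIsometryEquiv.neg ℝ).toHomeomorph.measurableEmbedding (fun ω => fderiv ℝ g 0 ω)
      simp only [LinearIsometryEquiv.coe_neg, map_neg, integral_neg] at this
      linarith
    simp only [zero_smul]
    rw [integral_const_mul, h1]
    simp
  · have e1 : fJ σ g t = Real.exp t * ∫ ω, g (Real.exp t • ω) * fderiv ℝ g (Real.exp t • ω) ω ∂σ := by
      unfold fJ sphM eulP
      rw [← integral_const_mul]
      congr 1
      ext ω
      simp only [map_smul, smul_eq_mul]
      ring
    rw [e1, ← mul_assoc]
    congr 1
    rw [← Real.exp_nat_mul, ← Real.exp_add, Nat.cast_sub hn]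
    congr 1
    push_cast
    ring

lemma fA_lim (hn : 1 ≤ n) (hS : ∀ᵐ ω ∂σ, ‖ω‖ = 1) (hg : ContDiff ℝ 2 g) :
    Tendsto (fun t => Real.exp ((n - 2) * t) * fA σ g t) atBot (𝓝 0) := by
  have hg1 : ContDiff ℝ 1 g := hg.of_le (by norm_num)
  have hD := hg1.continuous_fderiv (by simp)
  have hc : Continuous (fun r : ℝ => r ^ n *
      ∫ ω, fderiv ℝ g (r • ω) ω * fderiv ℝ g (r • ω) ω ∂σ) := by
    refine (continuous_pow _).mul (cont_param hS (F := fun r ω =>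
      fderiv ℝ g (r • ω) ω * fderiv ℝ g (r • ω) ω) ?_)
    exact ((hD.comp (continuous_fst.smul continuous_snd)).clm_apply continuous_snd).mul
      ((hD.comp (continuous_fst.smul continuous_snd)).clm_apply continuous_snd)
  refine (lim_aux hc ?_).congr fun t => ?_
  · rw [zero_pow (by omega), zero_mul]
  · have e1 : fA σ g t = Real.exp (2 * t) *
        ∫ ω, fderiv ℝ g (Real.exp t • ω) ω * fderiv ℝ g (Real.exp t • ω) ω ∂σ := by
      unfold fA sphM eulP
      rw [← integral_const_mul]
      congr 1
      ext ω
      simp only [map_smul, smul_eq_mul]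
      rw [two_mul, Real.exp_add]
      ring
    rw [e1, ← mul_assoc]
    congr 1
    rw [← Real.exp_nat_mul, ← Real.exp_add]
    congr 1
    ring

lemma fB_lim (hn : 1 ≤ n) (hS : ∀ᵐ ω ∂σ, ‖ω‖ = 1) (hg : ContDiff ℝ 2 g) :
    Tendsto (fun t => Real.exp ((n - 2) * t) * fB σ g t) atBot (𝓝 0) := by
  have hg1 : ContDiff ℝ 1 g := hg.of_le (by norm_num)
  have hD := hg1.continuous_fderiv (by simp)
  have hc : Continuous (fun r : ℝ => r ^ n *
      ∫ ω, (1/2) * ∑ i, ∑ j, fderiv ℝ g (r • ω) (rotA i j ω) *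
        fderiv ℝ g (r • ω) (rotA i j ω) ∂σ) := by
    refine (continuous_pow _).mul (cont_param hS (F := fun r ω =>
      (1/2) * ∑ i, ∑ j, fderiv ℝ g (r • ω) (rotA i j ω) *
        fderiv ℝ g (r • ω) (rotA i j ω)) ?_)
    have : ∀ i j : Fin n, Continuous (fun p : ℝ × ES n => fderiv ℝ g (p.1 • p.2) (rotA i j p.2)) :=
      fun i j => (hD.comp (continuous_fst.smul continuous_snd)).clm_apply
        ((rotA i j).continuous.comp continuous_snd)
    exact continuous_const.mul (continuous_finsetSum _ fun i _ => continuous_finsetSum _ fun j _ =>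
      (this i j).mul (this i j))
  refine (lim_aux hc ?_).congr fun t => ?_
  · rw [zero_pow (by omega), zero_mul]
  · have e1 : fB σ g t = Real.exp (2 * t) *
        ∫ ω, (1/2) * ∑ i, ∑ j, fderiv ℝ g (Real.exp t • ω) (rotA i j ω) *
        fderiv ℝ g (Real.exp t • ω) (rotA i j ω) ∂σ := by
      unfold fB sphM sGrad rotL
      rw [← integral_const_mul]
      congr 1
      ext ω
      simp only [map_smul, smul_eq_mul, Finset.mul_sum]
      refine Finset.sum_congr rfl fun _ _ => Finset.sum_congr rfl fun _ _ => ?_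
      rw [two_mul, Real.exp_add]
      ring
    rw [e1, ← mul_assoc]
    congr 1
    rw [← Real.exp_nat_mul, ← Real.exp_add]
    congr 1
    ring

lemma hasDerivAt_expc (c t : ℝ) : HasDerivAt (fun t => Real.exp (c * t)) (Real.exp (c*t) * c) t := by
  simpa using ((hasDerivAt_id t).const_mul c).exp

/-- monotone on `Iio T` and tending to zero at `-∞` implies nonnegative. -/
lemma nonneg_aux {φ φ' : ℝ → ℝ} {T : ℝ} (hd : ∀ t < T, HasDerivAt φ (φ' t) t)
    (h0 : ∀ t < T, 0 ≤ φ' t) (hlim : Tendsto φ atBot (𝓝 0)) {t : ℝ} (ht : t < T) : 0 ≤ φ t := by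
  have hmono : MonotoneOn φ (Set.Iio T) := by
    apply monotoneOn_of_deriv_nonneg (convex_Iio T)
    · exact fun t ht => (hd t ht).continuousAt.continuousWithinAt
    · rw [interior_Iio]
      exact fun t ht => (hd t ht).differentiableAt.differentiableWithinAt
    · rw [interior_Iio]
      intro t ht
      rw [(hd t ht).deriv]
      exact h0 t ht
  refine le_of_tendsto hlim ?_
  filter_upwards [eventually_le_atBot t] with s hs
  exact hmono (lt_of_le_of_lt hs ht) ht hs

lemma fJ_nonneg (hn : 1 ≤ n) (hS : ∀ᵐ ω ∂σ, ‖ω‖ = 1)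
    (hinv : ∀ e : ES n ≃ₗᵢ[ℝ] ES n, MeasurePreserving e σ σ) (hg : ContDiff ℝ 2 g)
    (hl : ∀ y, ‖y‖ < Real.exp T → lap g y = 0) {t : ℝ} (ht : t < T) : 0 ≤ fJ σ g t := by
  have := nonneg_aux (φ' := fun t => Real.exp ((n-2)*t) * (fA σ g t + fB σ g t))
    (fun t ht => ?_) (fun t ht => ?_) (fJ_lim hn hS hinv hg) ht
  · exact nonneg_of_mul_nonneg_right this (Real.exp_pos _)
  · refine ((hasDerivAt_expc (n-2) t).mul (fJ_deriv hS hinv hg hl ht)).congr_deriv ?_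
    ring
  · refine mul_nonneg (Real.exp_pos _).le (add_nonneg ?_ ?_)
    · exact integral_nonneg fun ω => mul_self_nonneg _
    · refine integral_nonneg fun ω => mul_nonneg (by norm_num) ?_
      exact Finset.sum_nonneg fun _ _ => Finset.sum_nonneg fun _ _ => mul_self_nonneg _

lemma pohozaev (hn : 1 ≤ n) (hS : ∀ᵐ ω ∂σ, ‖ω‖ = 1)
    (hinv : ∀ e : ES n ≃ₗᵢ[ℝ] ES n, MeasurePreserving e σ σ) (hg : ContDiff ℝ 2 g)
    (hl : ∀ y, ‖y‖ < Real.exp T → lap g y = 0) {t : ℝ} (ht : t < T) :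
    fB σ g t - fA σ g t - (n - 2) * fJ σ g t = 0 := by
  have hd : ∀ t < T, HasDerivAt (fun t => Real.exp ((n-2)*t) *
      (fB σ g t - fA σ g t - (n - 2) * fJ σ g t)) 0 t := by
    intro t ht
    refine ((hasDerivAt_expc (n-2) t).mul (((fB_deriv hS hg t).sub
      (fA_deriv hS hinv hg hl ht)).sub ((fJ_deriv hS hinv hg hl ht).const_mul _))).congr_deriv ?_
    simp only [Pi.sub_apply]
    ring
  have hlim : Tendsto (fun t => Real.exp ((n-2)*t) *
      (fB σ g t - fA σ g t - (n - 2) * fJ σ g t)) atBot (𝓝 0) := by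
    have := ((fB_lim hn hS hg).sub (fA_lim hn hS hg)).sub
      ((fJ_lim hn hS hinv hg).const_mul ((n:ℝ)-2))
    simp only [sub_zero, mul_zero] at this
    refine this.congr fun t => ?_
    ring
  have h1 := nonneg_aux hd (fun _ _ => le_rfl) hlim ht
  have h2 := nonneg_aux (φ := fun t => -(Real.exp ((n-2)*t) *
      (fB σ g t - fA σ g t - (n - 2) * fJ σ g t))) (φ' := fun _ => 0) (fun t ht => by simpa using! (hd t ht).neg)
    (fun _ _ => le_rfl) (by simpa using hlim.neg) ht
  have h3 : Real.exp ((n-2)*t) * (fB σ g t - fA σ g t - (n - 2) * fJ σ g t) = 0 := by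
    linarith
  exact (mul_eq_zero.1 h3).resolve_left (Real.exp_pos _).ne'

lemma cauchy_schwarz (hS : ∀ᵐ ω ∂σ, ‖ω‖ = 1) (hg : ContDiff ℝ 2 g) (t : ℝ)
    (hpos : 0 < fH σ g t) : fJ σ g t ^ 2 ≤ fA σ g t * fH σ g t := by
  have hg0 := hg.continuous
  have hP := (eulP_cd hg).continuous
  set a := fH σ g t with ha
  set b := fJ σ g t with hb
  have h0 : 0 ≤ sphM σ (fun y => (a * eulP g y - b * g y) * (a * eulP g y - b * g y)) t :=
    integral_nonneg fun ω => mul_self_nonneg _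
  have e : (fun y => (a * eulP g y - b * g y) * (a * eulP g y - b * g y)) = fun y =>
      a^2 * (eulP g y * eulP g y) + ((-2*a*b) * (g y * eulP g y) + b^2 * (g y * g y)) := by
    ext y; ring
  rw [e, sphM_add hS (by fun_prop) (by fun_prop), sphM_add hS (by fun_prop) (by fun_prop),
    sphM_smul, sphM_smul, sphM_smul] at h0
  change 0 ≤ a^2 * fA σ g t + (-2*a*b * fJ σ g t + b^2 * fH σ g t) at h0
  rw [← ha, ← hb] at h0
  have : 0 ≤ a * (fA σ g t * a - b^2) := by linarith
  have := nonneg_of_mul_nonneg_right this hpos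
  linarith

lemma log_convex (hn : 1 ≤ n) (hS : ∀ᵐ ω ∂σ, ‖ω‖ = 1)
    (hinv : ∀ e : ES n ≃ₗᵢ[ℝ] ES n, MeasurePreserving e σ σ) (hg : ContDiff ℝ 2 g)
    (hl : ∀ y, ‖y‖ < Real.exp T → lap g y = 0) (hpos : ∀ t < T, 0 < fH σ g t) :
    ConvexOn ℝ (Set.Iio T) (fun t => Real.log (fH σ g t)) := by
  have hd : ∀ t < T, HasDerivAt (fun t => Real.log (fH σ g t)) (2 * fJ σ g t / fH σ g t) t :=
    fun t ht => (fH_deriv hS hg t).log (hpos t ht).ne'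
  have hd2 : ∀ t < T, HasDerivAt (fun t => 2 * fJ σ g t / fH σ g t)
      (4 * (fA σ g t * fH σ g t - fJ σ g t ^2) / fH σ g t ^2) t := by
    intro t ht
    refine (((fJ_deriv hS hinv hg hl ht).const_mul 2).div (fH_deriv hS hg t)
      (hpos t ht).ne').congr_deriv ?_
    have hp := pohozaev hn hS hinv hg hl ht
    have : fB σ g t = fA σ g t + (n-2) * fJ σ g t := by linarith
    rw [this]
    ring
  have hmono : MonotoneOn (fun t => 2 * fJ σ g t / fH σ g t) (Set.Iio T) := by
    apply monotoneOn_of_deriv_nonneg (convex_Iio T)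
    · exact fun t ht => (hd2 t ht).continuousAt.continuousWithinAt
    · rw [interior_Iio]
      exact fun t ht => (hd2 t ht).differentiableAt.differentiableWithinAt
    · rw [interior_Iio]
      intro t ht
      rw [(hd2 t ht).deriv]
      have := cauchy_schwarz hS hg t (hpos t ht)
      exact div_nonneg (by linarith) (sq_nonneg _)
  apply MonotoneOn.convexOn_of_deriv (convex_Iio T)
  · exact fun t ht => (hd t ht).continuousAt.continuousWithinAt
  · rw [interior_Iio]
    exact fun t ht => (hd t ht).differentiableAt.differentiableWithinAt
  · rw [interior_Iio]
    intro s hs t ht hst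
    rw [(hd s hs).deriv, (hd t ht).deriv]
    exact hmono hs ht hst

end ODE

section Final

variable {n : ℕ}

lemma zero_on_sphere {σ : Measure (ES n)} [IsFiniteMeasure σ] (hS : ∀ᵐ ω ∂σ, ‖ω‖ = 1)
    (hinv : ∀ e : ES n ≃ₗᵢ[ℝ] ES n, MeasurePreserving e σ σ) (hσ : σ ≠ 0)
    {g : ES n → ℝ} (hg : Continuous g) {t : ℝ} (h0 : fH σ g t = 0) {ω₀ : ES n} (hω : ‖ω₀‖ = 1) :
    g (Real.exp t • ω₀) = 0 := by
  by_contra hne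
  apply hσ
  have hc : Continuous (fun ω : ES n => g (Real.exp t • ω)) := hg.comp (by fun_prop)
  set U : Set (ES n) := {ω | g (Real.exp t • ω) ≠ 0} with hU
  have hUo : IsOpen U := isOpen_ne_fun hc continuous_const
  have hU0 : σ U = 0 := by
    have h1 := (integral_eq_zero_iff_of_nonneg (fun ω => mul_self_nonneg _)
      (sphM_int hS (hg.mul hg) t)).1 h0
    have h2 : ∀ᵐ ω ∂σ, ω ∉ U := by
      filter_upwards [h1] with ω hω
      simpa [hU] using hω
    simpa using measure_eq_zero_iff_ae_notMem.2 h2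
  have hsph : σ (Metric.sphere 0 1) = 0 := by
    refine (isCompact_sphere (0 : ES n) 1).measure_zero_of_nhdsWithin fun v hv => ?_
    have hv1 : ‖v‖ = 1 := by simpa using hv
    let e := (ℝ ∙ (v - ω₀))ᗮ.reflection
    have he : e v = ω₀ := Submodule.reflection_sub (hv1.trans hω.symm)
    refine ⟨e ⁻¹' U, mem_nhdsWithin_of_mem_nhds
      ((hUo.preimage e.continuous).mem_nhds (by simpa [he, hU] using hne)), ?_⟩
    rw [(hinv e).measure_preimage hUo.measurableSet.nullMeasurableSet, hU0]
  have hcompl : σ (Metric.sphere 0 1)ᶜ = 0 := by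
    rw [← mem_ae_iff]
    filter_upwards [hS] with ω hω
    simp [hω]
  rw [← Measure.measure_univ_eq_zero, ← Set.union_compl_self (Metric.sphere (0 : ES n) 1)]
  exact measure_union_null hsph hcompl

lemma fH_pos (hn : 1 ≤ n) {σ : Measure (ES n)} [IsFiniteMeasure σ] (hS : ∀ᵐ ω ∂σ, ‖ω‖ = 1)
    (hinv : ∀ e : ES n ≃ₗᵢ[ℝ] ES n, MeasurePreserving e σ σ) (hσ : σ ≠ 0)
    {g : ES n → ℝ} (hg : ContDiff ℝ 2 g) {T : ℝ}
    (hl : ∀ y, ‖y‖ < Real.exp T → lap g y = 0)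
    (hnz : ∀ ε > 0, ∃ y ∈ Metric.ball (0 : ES n) ε, g y ≠ 0) {t : ℝ} (ht : t < T) :
    0 < fH σ g t := by
  have hnn : ∀ s, 0 ≤ fH σ g s := fun s => integral_nonneg fun ω => mul_self_nonneg _
  refine lt_of_le_of_ne (hnn t) fun h0 => ?_
  have hmono : MonotoneOn (fH σ g) (Set.Iio T) := by
    apply monotoneOn_of_deriv_nonneg (convex_Iio T)
    · exact fun t _ => (fH_deriv hS hg t).continuousAt.continuousWithinAt
    · exact fun t _ => (fH_deriv hS hg t).differentiableAt.differentiableWithinAt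
    · rw [interior_Iio]
      intro t ht
      rw [(fH_deriv hS hg t).deriv]
      have := fJ_nonneg hn hS hinv hg hl ht
      linarith
  have hz : ∀ s ≤ t, ∀ ω : ES n, ‖ω‖ = 1 → g (Real.exp s • ω) = 0 := by
    intro s hs ω hω
    refine zero_on_sphere hS hinv hσ hg.continuous ?_ hω
    exact le_antisymm ((hmono (lt_of_le_of_lt hs ht) ht hs).trans h0.symm.le) (hnn s)
  obtain ⟨y, hy, hgy⟩ := hnz (Real.exp t) (Real.exp_pos t)
  apply hgy
  by_cases hy0 : y = 0
  · subst hy0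
    let ω : ES n := bv ⟨0, hn⟩
    have hω : ‖ω‖ = 1 := by simp [ω]
    have h1 : Tendsto (fun s => g (Real.exp s • ω)) atBot (𝓝 (g 0)) := by
      have hc : Continuous (fun r : ℝ => g (r • ω)) := hg.continuous.comp (by fun_prop)
      have := (hc.tendsto 0).comp Real.tendsto_exp_atBot
      simpa [Function.comp_def] using this
    have h2 : Tendsto (fun s => g (Real.exp s • ω)) atBot (𝓝 0) := by
      refine tendsto_const_nhds.congr' ?_
      filter_upwards [eventually_le_atBot t] with s hs
      exact (hz s hs ω hω).symm
    exact tendsto_nhds_unique h1 h2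
  · have hyp : 0 < ‖y‖ := norm_pos_iff.2 hy0
    have hyt : ‖y‖ < Real.exp t := by simpa using hy
    have := hz (Real.log ‖y‖) ((Real.log_lt_iff_lt_exp hyp).2 hyt).le (‖y‖⁻¹ • y)
      (by rw [norm_smul, norm_inv, norm_norm, inv_mul_cancel₀ hyp.ne'])
    rwa [Real.exp_log hyp, smul_smul, mul_inv_cancel₀ hyp.ne', one_smul] at this

open Pointwise in
lemma sphere_scale {d : ℝ} (hd : 0 ≤ d) (x : ES n) {r : ℝ} (hr : 0 < r) :
    (Measure.hausdorffMeasure d).restrict (Metric.sphere x r) = (ENNReal.ofReal (r ^ d)) •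
      ((Measure.hausdorffMeasure d).restrict (Metric.sphere (0 : ES n) 1)).map
        (fun ω => x + r • ω) := by
  have hm : Measurable (fun ω : ES n => x + r • ω) := by fun_prop
  ext s hs
  rw [Measure.smul_apply, Measure.map_apply hm hs, Measure.restrict_apply hs,
    Measure.restrict_apply (hm hs)]
  have himg : s ∩ Metric.sphere x r =
      x +ᵥ (r • ((fun ω => x + r • ω) ⁻¹' s ∩ Metric.sphere (0 : ES n) 1)) := by
    ext y
    constructor
    · rintro ⟨hy, hyr⟩
      refine Set.mem_vadd_set.2 ⟨y - x, Set.mem_smul_set.2 ⟨r⁻¹ • (y - x), ⟨?_, ?_⟩, ?_⟩, ?_⟩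
      · simpa [smul_smul, hr.ne'] using hy
      · rw [mem_sphere_iff_norm] at hyr
        simp [norm_smul, hyr, abs_of_pos hr, hr.ne']
      · simp [smul_smul, hr.ne']
      · simp
    · intro hy
      obtain ⟨z, hz, rfl⟩ := Set.mem_vadd_set.1 hy
      obtain ⟨w, ⟨hw, hw1⟩, rfl⟩ := Set.mem_smul_set.1 hz
      refine ⟨hw, ?_⟩
      have : ‖w‖ = 1 := by simpa using hw1
      simp [norm_smul, this, abs_of_pos hr]
  rw [himg, hausdorffMeasure_vadd _ (Or.inl hd), Measure.hausdorffMeasure_smul₀ hd hr.ne']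
  rw [ENNReal.smul_def, smul_eq_mul, smul_eq_mul]
  congr 1
  rw [ENNReal.ofReal, ENNReal.coe_inj]
  ext
  rw [Real.coe_toNNReal _ (Real.rpow_nonneg hr.le _)]
  simp [abs_of_pos hr]

lemma sphere_inv (d : ℝ) (e : ES n ≃ₗᵢ[ℝ] ES n) :
    MeasurePreserving e ((Measure.hausdorffMeasure d).restrict (Metric.sphere (0 : ES n) 1))
      ((Measure.hausdorffMeasure d).restrict (Metric.sphere (0 : ES n) 1)) := by
  have h := (e.toIsometryEquiv.measurePreserving_hausdorffMeasure d).restrict_preimage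
    (Metric.isClosed_sphere (x := (0 : ES n)) (ε := 1)).measurableSet
  have : e.toIsometryEquiv ⁻¹' (Metric.sphere (0 : ES n) 1) = Metric.sphere 0 1 := by
    ext y; simp
  rw [this] at h
  exact h

lemma lap_congr {f k : ES n → ℝ} {y : ES n} (h : f =ᶠ[𝓝 y] k) : lap f y = lap k y := by
  unfold lap
  refine Finset.sum_congr rfl fun i _ => ?_
  have h1 : (fun z => fderiv ℝ f z (bv i)) =ᶠ[𝓝 y] (fun z => fderiv ℝ k z (bv i)) := by
    filter_upwards [h.fderiv (𝕜 := ℝ)] with z hz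
    rw [hz]
  rw [h1.fderiv_eq]

lemma lap_trans (f : ES n → ℝ) (x y : ES n) : lap (fun z => f (x + z)) y = lap f (x + y) := by
  unfold lap
  refine Finset.sum_congr rfl fun i _ => ?_
  simp_rw [fderiv_comp_add_left]
  rw [fderiv_comp_add_left (f := fun z => fderiv ℝ f z (bv i))]

lemma exists_ext {Ω : Set (ES n)} (hΩ : IsOpen Ω) {h : ES n → ℝ} {x : ES n} {R : ℝ}
    (hR : 0 < R) (hsub : Metric.closedBall x R ⊆ Ω)
    (hsm : ContDiffOn ℝ 2 h Ω) (hharm : ∀ y ∈ Ω, lap h y = 0) :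
    ∃ g : ES n → ℝ, ∃ R' > R, ContDiff ℝ 2 g ∧ (∀ y, ‖y‖ < R' → lap g y = 0) ∧
      ∀ y, ‖y‖ < R' → g y = h (x + y) := by
  obtain ⟨δ, hδ, hsubδ⟩ := (isCompact_closedBall x R).exists_cthickening_subset_open hΩ hsub
  rw [cthickening_closedBall hδ.le hR.le] at hsubδ
  let χ : ContDiffBump x := ⟨R + δ/2, δ + R, by positivity, by linarith⟩
  have hχ : ∀ z ∈ Metric.ball x (R + δ/2), χ z = 1 := fun z hz =>
    χ.one_of_mem_closedBall (Metric.ball_subset_closedBall hz)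
  have hcd : ContDiff ℝ 2 (fun z => χ z * h z) := by
    rw [contDiff_iff_contDiffAt]
    intro z
    by_cases hz : z ∈ Ω
    · exact χ.contDiff.contDiffAt.mul (hsm.contDiffAt (hΩ.mem_nhds hz))
    · have hz' : z ∉ tsupport χ := by
        rw [χ.tsupport_eq]
        intro hc
        apply hz
        apply hsubδ
        simpa [χ, add_comm] using hc
      rw [notMem_tsupport_iff_eventuallyEq] at hz'
      refine (contDiffAt_const (c := (0:ℝ))).congr_of_eventuallyEq ?_
      filter_upwards [hz'] with w hw
      simp [hw]
  have hball : ∀ y, ‖y‖ < R + δ/2 → x + y ∈ Metric.ball x (R + δ/2) := by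
    intro y hy; simpa using hy
  refine ⟨fun y => χ (x + y) * h (x + y), R + δ/2, by linarith, ?_, ?_, ?_⟩
  · exact hcd.comp (contDiff_const.add contDiff_id)
  · intro y hy
    rw [lap_trans (fun z => χ z * h z)]
    rw [lap_congr (k := h), hharm]
    · apply hsubδ
      apply Metric.ball_subset_closedBall
      exact Metric.ball_subset_ball (by linarith) (hball y hy)
    · filter_upwards [Metric.isOpen_ball.mem_nhds (hball y hy)] with z hz
      rw [hχ z hz, one_mul]
  · intro y hy
    simp only
    rw [hχ _ (hball y hy), one_mul]

end Final

end LogConv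


/-- Logarithmic convexity of spherical L² averages of a harmonic function
    (Agmon–Almgren). -/
theorem log_convexity_spherical_means (n : ℕ) (hn : 1 ≤ n)
    (Ω : Set (EuclideanSpace ℝ (Fin n))) (hΩ : IsOpen Ω)
    (h : EuclideanSpace ℝ (Fin n) → ℝ) (x : EuclideanSpace ℝ (Fin n)) (R : ℝ)
    (hR : 0 < R) (hsub : Metric.closedBall x R ⊆ Ω)
    (hsm : ContDiffOn ℝ 2 h Ω) (hharm : ∀ y ∈ Ω, lap h y = 0)
    (hnz : ∀ ε > 0, ∃ y ∈ Metric.ball x ε, h y ≠ 0) :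
    ConvexOn ℝ (Set.Iic (Real.log R)) (fun t =>
      Real.log
        ((∫ y in Metric.sphere x (Real.exp t), (h y)^2
            ∂(Measure.hausdorffMeasure ((n:ℝ) - 1))) /
          (Measure.hausdorffMeasure ((n:ℝ) - 1) (Metric.sphere x (Real.exp t))).toReal)) := by
  have hd : (0:ℝ) ≤ (n:ℝ) - 1 := by
    have : (1:ℝ) ≤ n := by exact_mod_cast hn
    linarith
  set d : ℝ := (n:ℝ) - 1 with hdd
  obtain ⟨g, R', hRR', hg, hl, hgh⟩ := exists_ext hΩ hR hsub hsm hharm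
  have hR' : 0 < R' := hR.trans hRR'
  set σ : Measure (EuclideanSpace ℝ (Fin n)) :=
    (Measure.hausdorffMeasure d).restrict (Metric.sphere 0 1) with hσ
  have hS : ∀ᵐ ω ∂σ, ‖ω‖ = 1 := by
    filter_upwards [ae_restrict_mem Metric.isClosed_sphere.measurableSet] with ω hω
    simpa using hω
  have hinv := sphere_inv (n := n) d
  set M : ℝ := (σ Set.univ).toReal with hM
  have key : ∀ t ∈ Set.Iic (Real.log R), Real.log
        ((∫ y in Metric.sphere x (Real.exp t), (h y)^2
            ∂(Measure.hausdorffMeasure d)) /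
          (Measure.hausdorffMeasure d (Metric.sphere x (Real.exp t))).toReal) =
      Real.log (fH σ g t / M) := by
    intro t ht
    have hr : 0 < Real.exp t := Real.exp_pos t
    have hrd : 0 < Real.exp t ^ d := Real.rpow_pos_of_pos hr d
    have htR : Real.exp t ≤ R := (Real.le_log_iff_exp_le hR).1 ht
    have hsc := sphere_scale hd x hr
    have hme : MeasurableEmbedding (fun ω : EuclideanSpace ℝ (Fin n) => x + Real.exp t • ω) :=
      ((Homeomorph.smulOfNeZero (Real.exp t) hr.ne').trans
        (Homeomorph.addLeft x)).measurableEmbedding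
    have h1 : (Measure.hausdorffMeasure d (Metric.sphere x (Real.exp t))).toReal =
        Real.exp t ^ d * M := by
      rw [← Measure.restrict_apply_univ, hsc, Measure.smul_apply,
        Measure.map_apply hme.measurable MeasurableSet.univ, Set.preimage_univ, smul_eq_mul,
        ENNReal.toReal_mul, ENNReal.toReal_ofReal hrd.le]
    have h2 : ∫ y in Metric.sphere x (Real.exp t), (h y)^2 ∂(Measure.hausdorffMeasure d) =
        Real.exp t ^ d * fH σ g t := by
      rw [hsc, integral_smul_measure, hme.integral_map, ENNReal.toReal_ofReal hrd.le, smul_eq_mul]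
      congr 1
      apply integral_congr_ae
      filter_upwards [hS] with ω hω
      rw [hgh]
      · ring
      · rw [norm_smul, hω]
        simpa using htR.trans_lt hRR'
    rw [h1, h2, mul_div_mul_left _ _ hrd.ne']
  refine ConvexOn.congr ?_ (fun t ht => (key t ht).symm)
  by_cases hM0 : M = 0
  · simp only [hM0, div_zero, Real.log_zero]
    exact convexOn_const _ (convex_Iic _)
  have hfin : IsFiniteMeasure σ := by
    refine ⟨lt_top_iff_ne_top.2 fun htop => hM0 ?_⟩
    rw [hM, htop, ENNReal.toReal_top]
  have hσ0 : σ ≠ 0 := by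
    intro h0
    apply hM0
    rw [hM, h0]
    simp
  have hl' : ∀ y, ‖y‖ < Real.exp (Real.log R') → lap g y = 0 := by
    rw [Real.exp_log hR']
    exact hl
  have hnz' : ∀ ε > 0, ∃ y ∈ Metric.ball (0 : EuclideanSpace ℝ (Fin n)) ε, g y ≠ 0 := by
    intro ε hε
    obtain ⟨y, hy, hy0⟩ := hnz (min ε R') (lt_min hε hR')
    have hyn : ‖y - x‖ < min ε R' := by rwa [← mem_ball_iff_norm]
    refine ⟨y - x, ?_, ?_⟩
    · rw [mem_ball_zero_iff]
      exact hyn.trans_le (min_le_left _ _)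
    · rw [hgh _ (hyn.trans_le (min_le_right _ _))]
      simpa using hy0
  have hpos : ∀ t < Real.log R', 0 < fH σ g t := fun t ht =>
    fH_pos hn hS hinv hσ0 hg hl' hnz' ht
  have hlt : Real.log R < Real.log R' := Real.log_lt_log hR hRR'
  have hconv := ((log_convex hn hS hinv hg hl' hpos).subset
    (fun t (ht : t ≤ Real.log R) => lt_of_le_of_lt ht hlt) (convex_Iic (Real.log R))).add_const
      (-Real.log M)
  refine hconv.congr fun t ht => ?_
  simp only [Pi.add_apply]
  rw [Real.log_div (hpos t (lt_of_le_of_lt ht hlt)).ne' hM0]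
  ring
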